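/- arXiv:1806.05866 — 2 statements merged into one kernel-verified Lean document; each statement's English description precedes it below -/
import Mathlib

section
/- Let G be a finite simple undirected graph with degree k_v at vertex v. Then the number of 5-arrows of G equals ∑_{(u,v)} C(k_u − 1, 2)(k_v − 1) − 2 · (number of tadpoles of G), where the sum is over all ordered pairs (u, v) of adjacent vertices. -/
/-- The number of tadpoles of `G`: subgraphs on 4 distinct vertices consisting of a triangle
`{a, b, c}` together with one additional edge of `G` joining a vertex of the triangle to the
fourth vertex `d`. -/
noncomputable def tadpoleCount {V : Type*} [DecidableEq V] (G : SimpleGraph V) : ℕ :=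
  Nat.card {T : Finset (Sym2 V) // ∃ a b c d : V, ([a, b, c, d] : List V).Nodup ∧
    G.Adj a b ∧ G.Adj b c ∧ G.Adj a c ∧ G.Adj a d ∧
    T = {s(a, b), s(b, c), s(a, c), s(a, d)}}

/-- The number of 5-arrows of `G`: trees on 5 distinct vertices with degree sequence
`(3, 2, 1, 1, 1)`, i.e. a central edge `uv` of `G` together with two further edges from `u`
to two distinct vertices `x`, `z` and one further edge from `v` to a vertex `y`. -/
noncomputable def fiveArrowCount {V : Type*} [DecidableEq V] (G : SimpleGraph V) : ℕ :=
  Nat.card {T : Finset (Sym2 V) // ∃ u v x y z : V, ([u, v, x, y, z] : List V).Nodup ∧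
    G.Adj u v ∧ G.Adj u x ∧ G.Adj u z ∧ G.Adj v y ∧
    T = {s(u, v), s(u, x), s(u, z), s(v, y)}}

theorem Finset.card_eq_two_mul_card_image {α β : Type*} [DecidableEq α] [DecidableEq β]
    (s : Finset α) (f : α → β) (σ : α → α) (hmem : ∀ t ∈ s, σ t ∈ s) (hne : ∀ t ∈ s, σ t ≠ t)
    (hfσ : ∀ t ∈ s, f (σ t) = f t)
    (hf : ∀ t ∈ s, ∀ t' ∈ s, f t' = f t → t' = t ∨ t' = σ t) :
    s.card = 2 * (s.image f).card := by
  rw [Finset.card_eq_sum_card_image f s, Finset.sum_const_nat (m := 2), mul_comm]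
  intro b hb
  obtain ⟨t, ht, rfl⟩ := Finset.mem_image.1 hb
  rw [← Finset.card_pair (hne t ht).symm]
  congr 1
  ext t'
  simp only [Finset.mem_filter, Finset.mem_insert, Finset.mem_singleton]
  constructor
  · rintro ⟨h, h'⟩
    exact hf t ht t' h h'
  · rintro (rfl | rfl)
    · exact ⟨ht, rfl⟩
    · exact ⟨hmem t ht, hfσ t ht⟩

section EdgeSets

variable {V : Type*} [DecidableEq V]

/-- The edge set of the 5-arrow with central edge `uv`, further edges `ux`, `uz` and `vy`. -/
def arrowEdges (u v x y z : V) : Finset (Sym2 V) :=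
  {s(u, v), s(u, x), s(u, z), s(v, y)}

/-- The edge set of the tadpole with triangle `abc` and further edge `ad`. -/
def tadpoleEdges (a b c d : V) : Finset (Sym2 V) :=
  {s(a, b), s(b, c), s(a, c), s(a, d)}

theorem mem_arrowEdges {u v x y z p q : V} :
    s(p, q) ∈ arrowEdges u v x y z ↔
      (p = u ∧ (q = v ∨ q = x ∨ q = z)) ∨ (q = u ∧ (p = v ∨ p = x ∨ p = z)) ∨
        (p = v ∧ q = y) ∨ (p = y ∧ q = v) := by
  simp only [arrowEdges, Finset.mem_insert, Finset.mem_singleton, Sym2.eq_iff]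
  tauto

theorem mem_tadpoleEdges {a b c d p q : V} :
    s(p, q) ∈ tadpoleEdges a b c d ↔
      (p = a ∧ (q = b ∨ q = c ∨ q = d)) ∨ (q = a ∧ (p = b ∨ p = c ∨ p = d)) ∨
        (p = b ∧ q = c) ∨ (p = c ∧ q = b) := by
  simp only [tadpoleEdges, Finset.mem_insert, Finset.mem_singleton, Sym2.eq_iff]
  tauto

theorem arrowEdges_swap (u v x y z : V) : arrowEdges u v z y x = arrowEdges u v x y z := by
  simp only [arrowEdges]
  grind

theorem tadpoleEdges_swap (a b c d : V) : tadpoleEdges a c b d = tadpoleEdges a b c d := by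
  simp only [tadpoleEdges, Sym2.eq_swap (a := c) (b := b)]
  grind

theorem arrowEdges_eq {u v x y z u' v' x' y' z' : V} (h : [u, v, x, y, z].Nodup)
    (h' : [u', v', x', y', z'].Nodup) (he : arrowEdges u' v' x' y' z' = arrowEdges u v x y z) :
    u' = u ∧ v' = v ∧ y' = y ∧ (x' = x ∧ z' = z ∨ x' = z ∧ z' = x) := by
  have h1 : s(u', v') ∈ arrowEdges u v x y z := he ▸ by simp [arrowEdges]
  have h2 : s(u', x') ∈ arrowEdges u v x y z := he ▸ by simp [arrowEdges]
  have h3 : s(u', z') ∈ arrowEdges u v x y z := he ▸ by simp [arrowEdges]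
  have h4 : s(v', y') ∈ arrowEdges u v x y z := he ▸ by simp [arrowEdges]
  rw [mem_arrowEdges] at h1 h2 h3 h4
  simp only [List.nodup_cons, List.mem_cons, List.not_mem_nil, or_false, not_or] at h h'
  have hu : u' = u := by
    by_contra hu
    simp only [hu, false_and, false_or] at h1 h2 h3
    grind
  subst hu
  grind

theorem tadpoleEdges_eq {a b c d a' b' c' d' : V} (h : [a, b, c, d].Nodup)
    (h' : [a', b', c', d'].Nodup) (he : tadpoleEdges a' b' c' d' = tadpoleEdges a b c d) :
    a' = a ∧ d' = d ∧ (b' = b ∧ c' = c ∨ b' = c ∧ c' = b) := by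
  have h1 : s(a', b') ∈ tadpoleEdges a b c d := he ▸ by simp [tadpoleEdges]
  have h2 : s(a', c') ∈ tadpoleEdges a b c d := he ▸ by simp [tadpoleEdges]
  have h3 : s(a', d') ∈ tadpoleEdges a b c d := he ▸ by simp [tadpoleEdges]
  have h4 : s(b', c') ∈ tadpoleEdges a b c d := he ▸ by simp [tadpoleEdges]
  rw [mem_tadpoleEdges] at h1 h2 h3 h4
  simp only [List.nodup_cons, List.mem_cons, List.not_mem_nil, or_false, not_or] at h h'
  have ha : a' = a := by
    by_contra ha
    simp only [ha, false_and, false_or] at h1 h2 h3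
    grind
  subst ha
  grind

end EdgeSets

section PreArrows

variable {V : Type*} [Fintype V] [DecidableEq V] (G : SimpleGraph V) [DecidableRel G.Adj]

/-- The tuples `⟨u, v, (x, z), y⟩` with `uv` an edge, `x ≠ z` neighbors of `u` other than `v`,
and `y` a neighbor of `v` other than `u`. -/
def preArrows : Finset (Σ _ : V, Σ _ : V, (V × V) × V) :=
  Finset.univ.sigma fun u => (G.neighborFinset u).sigma fun v =>
    ((G.neighborFinset u).erase v).offDiag ×ˢ (G.neighborFinset v).erase u

variable {G} in
theorem mem_preArrows {u v x z y : V} :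
    ⟨u, v, (x, z), y⟩ ∈ preArrows G ↔
      G.Adj u v ∧ G.Adj u x ∧ G.Adj u z ∧ G.Adj v y ∧ x ≠ v ∧ z ≠ v ∧ x ≠ z ∧ y ≠ u := by
  simp only [preArrows, Finset.mem_sigma, Finset.mem_univ, true_and, Finset.mem_product,
    Finset.mem_offDiag, Finset.mem_erase, SimpleGraph.mem_neighborFinset]
  tauto

theorem card_preArrows :
    (preArrows G).card = 2 * ∑ u, ∑ v ∈ G.neighborFinset u,
      (G.degree u - 1).choose 2 * (G.degree v - 1) := by
  simp only [preArrows, Finset.card_sigma, Finset.mul_sum]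
  refine Finset.sum_congr rfl fun u _ => Finset.sum_congr rfl fun v hv => ?_
  have huv : G.Adj u v := by simpa using hv
  rw [Finset.card_product, Finset.offDiag_card, Finset.card_erase_of_mem hv,
    Finset.card_erase_of_mem (by simpa using huv.symm), G.card_neighborFinset_eq_degree,
    G.card_neighborFinset_eq_degree, ← mul_assoc, Nat.choose_two_right,
    Nat.mul_div_cancel' (Nat.even_mul_pred_self _).two_dvd, Nat.mul_sub_one (G.degree u - 1) (G.degree u - 1)]

theorem card_preArrows_filter_arrow :
    ((preArrows G).filter fun t => t.2.2.2 ≠ t.2.2.1.1 ∧ t.2.2.2 ≠ t.2.2.1.2).card =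
      2 * fiveArrowCount G := by
  rw [Finset.card_eq_two_mul_card_image _
    (fun t => arrowEdges t.1 t.2.1 t.2.2.1.1 t.2.2.2 t.2.2.1.2)
    (fun t => ⟨t.1, t.2.1, (t.2.2.1.2, t.2.2.1.1), t.2.2.2⟩), fiveArrowCount]
  · congr 1
    refine (Nat.subtype_card _ fun T => ?_).symm
    simp only [Finset.mem_image, Finset.mem_filter, Sigma.exists, Prod.exists, mem_preArrows]
    constructor
    · rintro ⟨u, v, x, z, y, ⟨⟨h1, h2, h3, h4, h5⟩, h6⟩, rfl⟩
      refine ⟨u, v, x, y, z, ?_, h1, h2, h3, h4, rfl⟩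
      have := h1.ne; have := h2.ne; have := h3.ne; have := h4.ne
      simp
      grind
    · rintro ⟨u, v, x, y, z, hn, h1, h2, h3, h4, rfl⟩
      refine ⟨u, v, x, z, y, ⟨⟨h1, h2, h3, h4, ?_⟩, ?_⟩, rfl⟩ <;> simp at hn <;> grind
  · rintro ⟨u, v, ⟨x, z⟩, y⟩
    simp only [Finset.mem_filter, mem_preArrows]
    grind
  · rintro ⟨u, v, ⟨x, z⟩, y⟩
    simp only [Finset.mem_filter, mem_preArrows]
    simp
    grind
  · rintro ⟨u, v, ⟨x, z⟩, y⟩ -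
    exact arrowEdges_swap ..
  · rintro ⟨u, v, ⟨x, z⟩, y⟩ h ⟨u', v', ⟨x', z'⟩, y'⟩ h' he
    simp only [Finset.mem_filter, mem_preArrows] at h h'
    obtain ⟨⟨h1, h2, h3, h4, h5⟩, h6⟩ := h
    obtain ⟨⟨h1', h2', h3', h4', h5'⟩, h6'⟩ := h'
    have := h1.ne; have := h2.ne; have := h3.ne; have := h4.ne
    have := h1'.ne; have := h2'.ne; have := h3'.ne; have := h4'.ne
    have := arrowEdges_eq (by simp; grind) (by simp; grind) he
    grind

theorem card_preArrows_filter_eq_fst :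
    ((preArrows G).filter fun t => t.2.2.2 = t.2.2.1.1).card = 2 * tadpoleCount G := by
  rw [Finset.card_eq_two_mul_card_image _
    (fun t => tadpoleEdges t.1 t.2.1 t.2.2.1.1 t.2.2.1.2)
    (fun t => ⟨t.1, t.2.2.1.1, (t.2.1, t.2.2.1.2), t.2.1⟩), tadpoleCount]
  · congr 1
    refine (Nat.subtype_card _ fun T => ?_).symm
    simp only [Finset.mem_image, Finset.mem_filter, Sigma.exists, Prod.exists, mem_preArrows]
    constructor
    · rintro ⟨u, v, x, z, y, ⟨⟨h1, h2, h3, h4, h5⟩, rfl⟩, rfl⟩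
      refine ⟨u, v, y, z, ?_, h1, h4, h2, h3, rfl⟩
      have := h1.ne; have := h2.ne; have := h3.ne; have := h4.ne
      simp
      grind
    · rintro ⟨a, b, c, d, hn, h1, h2, h3, h4, rfl⟩
      refine ⟨a, b, c, d, c, ⟨⟨h1, h3, h4, h2, ?_⟩, rfl⟩, rfl⟩
      simp at hn
      grind
  · rintro ⟨u, v, ⟨x, z⟩, y⟩
    simp only [Finset.mem_filter, mem_preArrows]
    rintro ⟨⟨h1, h2, h3, h4, h5⟩, rfl⟩
    have := h1.ne; have := h4.ne; have := h4.symm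
    grind
  · rintro ⟨u, v, ⟨x, z⟩, y⟩
    simp only [Finset.mem_filter, mem_preArrows]
    simp
    grind
  · rintro ⟨u, v, ⟨x, z⟩, y⟩ -
    exact tadpoleEdges_swap ..
  · rintro ⟨u, v, ⟨x, z⟩, y⟩ h ⟨u', v', ⟨x', z'⟩, y'⟩ h' he
    simp only [Finset.mem_filter, mem_preArrows] at h h'
    obtain ⟨⟨h1, h2, h3, h4, h5⟩, h6⟩ := h
    obtain ⟨⟨h1', h2', h3', h4', h5'⟩, h6'⟩ := h'
    have := h1.ne; have := h2.ne; have := h3.ne; have := h4.ne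
    have := h1'.ne; have := h2'.ne; have := h3'.ne; have := h4'.ne
    have := tadpoleEdges_eq (by simp; grind) (by simp; grind) he
    grind

theorem card_preArrows_filter_eq_snd :
    ((preArrows G).filter fun t => t.2.2.2 = t.2.2.1.2).card = 2 * tadpoleCount G := by
  rw [← card_preArrows_filter_eq_fst]
  refine Finset.card_nbij' (fun t => ⟨t.1, t.2.1, t.2.2.1.swap, t.2.2.2⟩)
    (fun t => ⟨t.1, t.2.1, t.2.2.1.swap, t.2.2.2⟩) ?_ ?_ (fun _ _ => rfl) (fun _ _ => rfl) <;>
  · rintro ⟨u, v, ⟨x, z⟩, y⟩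
    simp only [Finset.coe_filter, Set.mem_ofPred_eq, Prod.swap, mem_preArrows]
    grind

theorem card_preArrows_eq_add :
    (preArrows G).card = 2 * fiveArrowCount G + 4 * tadpoleCount G := by
  have h := card_preArrows_filter_arrow G
  have h₁ := card_preArrows_filter_eq_fst G
  have h₂ := card_preArrows_filter_eq_snd G
  have key : (preArrows G).card =
      ((preArrows G).filter fun t => t.2.2.2 ≠ t.2.2.1.1 ∧ t.2.2.2 ≠ t.2.2.1.2).card +
      (((preArrows G).filter fun t => t.2.2.2 = t.2.2.1.1).card +
      ((preArrows G).filter fun t => t.2.2.2 = t.2.2.1.2).card) := by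
    rw [Finset.card_eq_sum_ones, Finset.card_filter, Finset.card_filter, Finset.card_filter,
      ← Finset.sum_add_distrib, ← Finset.sum_add_distrib]
    refine Finset.sum_congr rfl ?_
    rintro ⟨u, v, ⟨x, z⟩, y⟩ ht
    have := mem_preArrows.1 ht
    grind
  omega

end PreArrows

theorem stmt10 {V : Type*} [Fintype V] [DecidableEq V] (G : SimpleGraph V)
    [DecidableRel G.Adj] :
    (fiveArrowCount G : ℤ) =
      (∑ u, ∑ v ∈ G.neighborFinset u,
        (((G.degree u - 1).choose 2 * (G.degree v - 1) : ℕ) : ℤ))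
      - 2 * (tadpoleCount G : ℤ) := by
  have h := (card_preArrows G).symm.trans (card_preArrows_eq_add G)
  push_cast [← Nat.cast_sum]
  zify at h
  linarith
end

section
/- For an integer n ≥ 7, let H_n be the simple undirected graph on vertex set {0, 1, …, n−1} in which the vertices 0, 1, 2, 3, 4 are pairwise adjacent, vertices i and i+1 are adjacent for every i with 4 ≤ i ≤ n−2, and there are no other edges. Then H_n has exactly 5 4-cliques and exactly n + 95 4-vertex tree subgraphs; consequently C(4) = 80/(n + 95). -/
/-- The graph on `{0, 1, …, n-1}` in which `0, 1, 2, 3, 4` are pairwise adjacent, `i` and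
`i + 1` are adjacent for every `4 ≤ i ≤ n - 2`, and there are no other edges. -/
def chainK5 (n : ℕ) : SimpleGraph (Fin n) :=
  SimpleGraph.fromRel (fun i j =>
    ((i : ℕ) < 5 ∧ (j : ℕ) < 5) ∨ ((j : ℕ) = (i : ℕ) + 1 ∧ 4 ≤ (i : ℕ)))

/-- The number of `b`-cliques of `G`: `b`-element sets of pairwise adjacent vertices. -/
noncomputable def cliqueCount {V : Type*} (G : SimpleGraph V) (b : ℕ) : ℕ :=
  Nat.card {S : Finset V // S.card = b ∧ G.IsClique ↑S}

/-- The number of `b`-vertex tree subgraphs of `G`: pairs of a set `S` of `b` vertices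
together with `b - 1` edges of `G` between vertices of `S` forming a connected acyclic
graph spanning `S`. -/
noncomputable def treeSubCount {V : Type*} (G : SimpleGraph V) (b : ℕ) : ℕ :=
  Nat.card {p : Finset V × Finset (Sym2 V) //
    p.1.card = b ∧ p.2.card = b - 1 ∧
    (∀ e ∈ p.2, e ∈ G.edgeSet) ∧
    (∀ e ∈ p.2, ∀ v ∈ e, v ∈ p.1) ∧
    (∀ u ∈ p.1, ∀ v ∈ p.1, (SimpleGraph.fromEdgeSet (↑p.2 : Set (Sym2 V))).Reachable u v) ∧
    (SimpleGraph.fromEdgeSet (↑p.2 : Set (Sym2 V))).IsAcyclic}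

open Finset

/-- `E` is the edge set of a path or of a star on four distinct vertices. -/
def IsFourTree {V : Type*} [DecidableEq V] (E : Finset (Sym2 V)) : Prop :=
  ∃ a b c d : V, a ≠ b ∧ a ≠ c ∧ a ≠ d ∧ b ≠ c ∧ b ≠ d ∧ c ≠ d ∧
    (E = {s(a, b), s(b, c), s(c, d)} ∨ E = {s(a, b), s(a, c), s(a, d)})

/-- The set of endpoints of the members of `E`. -/
def endpoints {V : Type*} [DecidableEq V] (E : Finset (Sym2 V)) : Finset V :=
  E.biUnion Sym2.toFinset

theorem mem_endpoints {V : Type*} [DecidableEq V] {E : Finset (Sym2 V)} {v : V} :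
    v ∈ endpoints E ↔ ∃ e ∈ E, v ∈ e := by
  simp [endpoints]

theorem isFourTree_cherry_insert {V : Type*} [DecidableEq V] {a b c x y : V} (hba : b ≠ a)
    (hbc : b ≠ c) (hac : a ≠ c) (hx : x = a ∨ x = b ∨ x = c) (hya : y ≠ a) (hyb : y ≠ b)
    (hyc : y ≠ c) : IsFourTree {s(b, a), s(b, c), s(x, y)} := by
  rcases hx with rfl | rfl | rfl
  · refine ⟨c, b, x, y, by grind, by grind, by grind, by grind, by grind, by grind, .inl ?_⟩
    ext e; simp [Sym2.eq_swap]; tauto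
  · exact ⟨x, a, c, y, by grind, by grind, by grind, by grind, by grind, by grind, .inr rfl⟩
  · refine ⟨a, b, x, y, by grind, by grind, by grind, by grind, by grind, by grind, .inl ?_⟩
    rw [Sym2.eq_swap (a := b) (b := a)]

theorem isFourTree_cherry {V : Type*} [DecidableEq V] {a b c x y : V} (hba : b ≠ a)
    (hbc : b ≠ c) (hac : a ≠ c) (hxy : x ≠ y) (hcard : ({a, b, c, x, y} : Finset V).card = 4) :
    IsFourTree {s(b, a), s(b, c), s(x, y)} := by
  by_cases hx : x = a ∨ x = b ∨ x = c
  · have hy : ¬ (y = a ∨ y = b ∨ y = c) := by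
      intro hy
      have : ({a, b, c, x, y} : Finset V) ⊆ {a, b, c} := by grind
      have := Finset.card_le_card this
      have := Finset.card_le_three (a := a) (b := b) (c := c)
      omega
    exact isFourTree_cherry_insert hba hbc hac hx (by tauto) (by tauto) (by tauto)
  · have hy : y = a ∨ y = b ∨ y = c := by
      by_contra hy
      rw [card_insert_of_notMem (by grind), card_insert_of_notMem (by grind),
        card_insert_of_notMem (by grind), card_pair hxy] at hcard
      omega
    rw [Sym2.eq_swap (a := x)]
    exact isFourTree_cherry_insert hba hbc hac hy (by tauto) (by tauto) (by tauto)

theorem isFourTree_of_inter {V : Type*} [DecidableEq V] {a b c d x y : V} (hab : a ≠ b)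
    (hcd : c ≠ d) (hne : s(a, b) ≠ s(c, d)) (hxy : x ≠ y)
    (hcard : ({a, b, c, d, x, y} : Finset V).card = 4)
    (hinter : a = c ∨ a = d ∨ b = c ∨ b = d) :
    IsFourTree {s(a, b), s(c, d), s(x, y)} := by
  rw [Ne, Sym2.eq_iff] at hne
  rcases hinter with rfl | rfl | rfl | rfl
  · exact isFourTree_cherry hab hcd (by tauto) hxy (by rw [← hcard]; congr 1; grind)
  · rw [Sym2.eq_swap (a := c)]
    exact isFourTree_cherry hab hcd.symm (by tauto) hxy (by rw [← hcard]; congr 1; grind)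
  · rw [Sym2.eq_swap (a := a)]
    exact isFourTree_cherry hab.symm hcd (by tauto) hxy (by rw [← hcard]; congr 1; grind)
  · rw [Sym2.eq_swap (a := a), Sym2.eq_swap (a := c)]
    exact isFourTree_cherry hab.symm hcd.symm (by tauto) hxy
      (by rw [← hcard]; congr 1; grind)

theorem isFourTree_of_card {V : Type*} [DecidableEq V] {E : Finset (Sym2 V)}
    (hE : E.card = 3) (hdiag : ∀ e ∈ E, ¬ e.IsDiag) (hcard : (endpoints E).card = 4) :
    IsFourTree E := by
  obtain ⟨e, f, g, hef, heg, hfg, rfl⟩ := Finset.card_eq_three.mp hE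
  induction e with | _ a b
  induction f with | _ c d
  induction g with | _ x y
  have h : endpoints {s(a, b), s(c, d), s(x, y)} = {a, b, c, d, x, y} := by
    ext; simp [mem_endpoints]; tauto
  rw [h] at hcard
  simp only [mem_insert, mem_singleton, forall_eq_or_imp, forall_eq, Sym2.mk_isDiag_iff]
    at hdiag
  obtain ⟨hab, hcd, hxy⟩ := hdiag
  by_cases h₁ : a = c ∨ a = d ∨ b = c ∨ b = d
  · exact isFourTree_of_inter hab hcd hef hxy hcard h₁
  by_cases h₂ : a = x ∨ a = y ∨ b = x ∨ b = y
  · rw [pair_comm]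
    exact isFourTree_of_inter hab hxy heg hcd (by rw [← hcard]; congr 1; grind) h₂
  exfalso
  push Not at h₁ h₂
  have habcd : ({a, b, c, d} : Finset V).card = 4 := by simp [*]
  have hsub : ({a, b, c, d} : Finset V) = {a, b, c, d, x, y} :=
    eq_of_subset_of_card_le (by grind) (by omega)
  have hx : x ∈ ({a, b, c, d} : Finset V) := by rw [hsub]; simp
  have hy : y ∈ ({a, b, c, d} : Finset V) := by rw [hsub]; simp
  rw [Ne, Sym2.eq_iff] at hfg
  grind

theorem IsFourTree.reachable {V : Type*} [DecidableEq V] {E : Finset (Sym2 V)}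
    (h : IsFourTree E) : ∀ u ∈ endpoints E, ∀ v ∈ endpoints E,
      (SimpleGraph.fromEdgeSet (E : Set (Sym2 V))).Reachable u v := by
  have key : ∀ x y, x ≠ y → s(x, y) ∈ E →
      (SimpleGraph.fromEdgeSet (E : Set (Sym2 V))).Reachable x y := fun x y hxy hmem =>
    SimpleGraph.Adj.reachable (by simpa [hxy] using hmem)
  suffices h : ∃ r, ∀ u ∈ endpoints E,
      (SimpleGraph.fromEdgeSet (E : Set (Sym2 V))).Reachable r u by
    obtain ⟨r, hr⟩ := h
    exact fun u hu v hv => (hr u hu).symm.trans (hr v hv)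
  obtain ⟨a, b, c, d, hab, hac, had, hbc, hbd, hcd, rfl | rfl⟩ := h
  all_goals
    refine ⟨a, fun u hu => ?_⟩
    replace hu : u = a ∨ u = b ∨ u = c ∨ u = d := by
      simp [mem_endpoints] at hu; tauto
  · have h1 := key a b hab (by simp)
    have h2 := key b c hbc (by simp)
    have h3 := key c d hcd (by simp)
    rcases hu with rfl | rfl | rfl | rfl
    exacts [.rfl, h1, h1.trans h2, (h1.trans h2).trans h3]
  · rcases hu with rfl | rfl | rfl | rfl
    exacts [.rfl, key _ _ hab (by simp), key _ _ hac (by simp), key _ _ had (by simp)]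

theorem not_reachable_fromEdgeSet {V : Type*} {E : Set (Sym2 V)} {u v : V} (huv : u ≠ v)
    (h : ∀ e ∈ E, v ∉ e) : ¬ (SimpleGraph.fromEdgeSet E).Reachable u v := by
  intro hr
  obtain ⟨p⟩ := hr.symm
  cases p with
  | nil => exact huv rfl
  | cons hadj _ => exact h _ (SimpleGraph.fromEdgeSet_adj _ |>.mp hadj).1 (by simp)

theorem isAcyclic_fromEdgeSet_insert {V : Type*} {E : Set (Sym2 V)} {u v : V} (huv : u ≠ v)
    (h : ∀ e ∈ E, v ∉ e) (hE : (SimpleGraph.fromEdgeSet E).IsAcyclic) :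
    (SimpleGraph.fromEdgeSet (insert s(u, v) E)).IsAcyclic := by
  have := hE.sup_edge_of_not_reachable (not_reachable_fromEdgeSet huv h)
  rwa [SimpleGraph.edge, ← SimpleGraph.fromEdgeSet_union, Set.union_comm, Set.singleton_union] at this

theorem IsFourTree.isAcyclic {V : Type*} [DecidableEq V] {E : Finset (Sym2 V)}
    (h : IsFourTree E) : (SimpleGraph.fromEdgeSet (E : Set (Sym2 V))).IsAcyclic := by
  obtain ⟨a, b, c, d, hab, hac, had, hbc, hbd, hcd, rfl | rfl⟩ := h
  · rw [Sym2.eq_swap (a := a), Sym2.eq_swap (a := b) (b := c)]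
    push_cast
    rw [← insert_empty_eq s(c, d)]
    refine isAcyclic_fromEdgeSet_insert hab.symm ?_ (isAcyclic_fromEdgeSet_insert hbc.symm ?_
      (isAcyclic_fromEdgeSet_insert hcd ?_ ?_)) <;> simp [*]
  · push_cast
    rw [← insert_empty_eq s(a, d)]
    refine isAcyclic_fromEdgeSet_insert hab ?_ (isAcyclic_fromEdgeSet_insert hac ?_
      (isAcyclic_fromEdgeSet_insert had ?_ ?_)) <;> simp [*, Ne.symm]

/-- Adjacency of `i < j` in the union of the graphs `chainK5 n`. -/
def chainRel (i j : ℕ) : Prop := i < j ∧ (j < 5 ∨ (j = i + 1 ∧ 4 ≤ i))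

instance : DecidableRel chainRel := fun _ _ => by unfold chainRel; infer_instance

/-- The edges of `chainK5 n`, as unordered pairs of natural numbers. -/
def chainEdges (n : ℕ) : Finset (Sym2 ℕ) :=
  ((range n ×ˢ range n).filter (fun p => chainRel p.1 p.2)).image (fun p => s(p.1, p.2))

theorem card_filter_card_endpoints_chainEdges_seven : ((powersetCard 3 (chainEdges 7)).filter
    (fun E => (endpoints E).card = 4)).card = 102 := by
  decide +kernel

theorem mem_chainEdges {n i j : ℕ} :
    s(i, j) ∈ chainEdges n ↔ i < n ∧ j < n ∧ (chainRel i j ∨ chainRel j i) := by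
  simp only [chainEdges, mem_image, mem_filter, mem_product, mem_range, Prod.exists, Sym2.eq_iff]
  constructor
  · rintro ⟨a, b, ⟨⟨h1, h2⟩, h3⟩, ⟨rfl, rfl⟩ | ⟨rfl, rfl⟩⟩ <;> tauto
  · rintro ⟨h1, h2, h | h⟩
    exacts [⟨i, j, by tauto⟩, ⟨j, i, by tauto⟩]

theorem mem_edgeSet_chainK5 {n : ℕ} (e : Sym2 (Fin n)) :
    e ∈ (chainK5 n).edgeSet ↔ e.map Fin.val ∈ chainEdges n := by
  induction e with | _ i j
  simp only [chainK5, SimpleGraph.mem_edgeSet, SimpleGraph.fromRel_adj, Sym2.map_mk,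
    mem_chainEdges, chainRel, i.2, j.2, true_and, Ne, Fin.ext_iff]
  omega

theorem IsFourTree.card_endpoints {V : Type*} [DecidableEq V] {E : Finset (Sym2 V)}
    (h : IsFourTree E) : (endpoints E).card = 4 := by
  obtain ⟨a, b, c, d, hab, hac, had, hbc, hbd, hcd, rfl | rfl⟩ := h
  all_goals
    rw [show (4 : ℕ) = ({a, b, c, d} : Finset V).card by simp [*]]
    congr 1
    ext
    simp [mem_endpoints]
    tauto

theorem IsFourTree.card_eq_three {V : Type*} [DecidableEq V] {E : Finset (Sym2 V)}
    (h : IsFourTree E) : E.card = 3 := by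
  obtain ⟨a, b, c, d, hab, hac, had, hbc, hbd, hcd, rfl | rfl⟩ := h <;>
    simp [Finset.card_insert_of_notMem, *, Ne.symm]

theorem isFourTree_map {V W : Type*} [DecidableEq V] [DecidableEq W] (f : V ↪ W)
    {E : Finset (Sym2 V)} : IsFourTree (E.map f.sym2Map) ↔ IsFourTree E := by
  constructor
  · intro h
    have hcard := h.card_endpoints
    have hmap : endpoints (E.map f.sym2Map) = (endpoints E).map f := by
      ext v
      simp only [mem_endpoints, Finset.mem_map, Function.Embedding.sym2Map_apply]
      constructor
      · rintro ⟨_, ⟨e, he, rfl⟩, hv⟩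
        obtain ⟨w, hw, rfl⟩ := Sym2.mem_map.mp hv
        exact ⟨w, ⟨e, he, hw⟩, rfl⟩
      · rintro ⟨w, ⟨e, he, hw⟩, rfl⟩
        exact ⟨_, ⟨e, he, rfl⟩, Sym2.mem_map.mpr ⟨w, hw, rfl⟩⟩
    rw [hmap, card_map] at hcard
    refine isFourTree_of_card (by rw [← h.card_eq_three, card_map]) (fun e he hdiag => ?_) hcard
    induction e with | _ x y
    have hmem : s(f x, f y) ∈ E.map f.sym2Map := Finset.mem_map.mpr ⟨_, he, rfl⟩
    rw [Sym2.mk_isDiag_iff] at hdiag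
    subst hdiag
    obtain ⟨a, b, c, d, hab, hac, had, hbc, hbd, hcd, h | h⟩ := h <;>
    · rw [h] at hmem
      simp at hmem
      grind
  · rintro ⟨a, b, c, d, hab, hac, had, hbc, hbd, hcd, rfl | rfl⟩
    · exact ⟨f a, f b, f c, f d, by simpa, by simpa, by simpa, by simpa, by simpa, by simpa,
        .inl (by simp)⟩
    · exact ⟨f a, f b, f c, f d, by simpa, by simpa, by simpa, by simpa, by simpa, by simpa,
        .inr (by simp)⟩

theorem treeSub_four_iff {V : Type*} [DecidableEq V] (G : SimpleGraph V)
    (p : Finset V × Finset (Sym2 V)) :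
    (p.1.card = 4 ∧ p.2.card = 4 - 1 ∧
      (∀ e ∈ p.2, e ∈ G.edgeSet) ∧
      (∀ e ∈ p.2, ∀ v ∈ e, v ∈ p.1) ∧
      (∀ u ∈ p.1, ∀ v ∈ p.1, (SimpleGraph.fromEdgeSet (↑p.2 : Set (Sym2 V))).Reachable u v) ∧
      (SimpleGraph.fromEdgeSet (↑p.2 : Set (Sym2 V))).IsAcyclic) ↔
    p.1 = endpoints p.2 ∧ IsFourTree p.2 ∧ ∀ e ∈ p.2, e ∈ G.edgeSet := by
  obtain ⟨S, E⟩ := p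
  constructor
  · rintro ⟨hS, hE, hG, hsub, hreach, -⟩
    have hSE : S = endpoints E := by
      ext v
      rw [mem_endpoints]
      refine ⟨fun hv => ?_, fun ⟨e, he, hv⟩ => hsub e he v hv⟩
      obtain ⟨w, hw, hwv⟩ := Finset.exists_mem_ne (a := v) (s := S) (by simp at hS; omega)
      by_contra hcon
      push Not at hcon
      exact not_reachable_fromEdgeSet hwv (fun e he => hcon e he) (hreach w hw v hv)
    exact ⟨hSE, isFourTree_of_card hE (fun e he => G.not_isDiag_of_mem_edgeSet (hG e he))
      (hSE ▸ hS), hG⟩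
  · rintro ⟨hS, h, hG⟩
    dsimp only at hS
    subst hS
    exact ⟨h.card_endpoints, h.card_eq_three, hG,
      fun e he v hv => mem_endpoints.mpr ⟨e, he, hv⟩, h.reachable, h.isAcyclic⟩

theorem treeSubCount_four {V : Type*} [DecidableEq V] (G : SimpleGraph V) :
    treeSubCount G 4 =
      Set.ncard {E : Finset (Sym2 V) | IsFourTree E ∧ ∀ e ∈ E, e ∈ G.edgeSet} := by
  rw [← Set.ncard_image_of_injective _ (f := fun E => (endpoints E, E))
    (fun E F h => congrArg Prod.snd h)]
  refine (Nat.card_congr (Equiv.subtypeEquivRight fun p => ?_)).trans (Nat.card_coe_set_eq _)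
  rw [treeSub_four_iff]
  constructor
  · exact fun ⟨hS, hE⟩ => ⟨p.2, hE, Prod.ext hS.symm rfl⟩
  · rintro ⟨E, hE, rfl⟩
    exact ⟨rfl, hE⟩

theorem path_edges_reverse {V : Type*} [DecidableEq V] (a b c d : V) :
    ({s(a, b), s(b, c), s(c, d)} : Finset (Sym2 V)) = {s(d, c), s(c, b), s(b, a)} := by
  rw [Sym2.eq_swap (a := d), Sym2.eq_swap (a := c) (b := b), Sym2.eq_swap (a := b) (b := a)]
  grind

/-- The edges of the four-vertex path ending at `m`. -/
def tailPath (m : ℕ) : Finset (Sym2 ℕ) := {s(m - 3, m - 2), s(m - 2, m - 1), s(m - 1, m)}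

/-- The edge sets of the four-vertex trees of `chainK5 n`: those on the vertices below `7`, and
the paths ending at a vertex `m ≥ 7`. -/
def chainTrees (n : ℕ) : Finset (Finset (Sym2 ℕ)) :=
  (powersetCard 3 (chainEdges 7)).filter (fun E => (endpoints E).card = 4) ∪
    (Ico 7 n).image tailPath

theorem isFourTree_tailPath {m : ℕ} (hm : 7 ≤ m) : IsFourTree (tailPath m) :=
  ⟨m - 3, m - 2, m - 1, m, by omega, by omega, by omega, by omega, by omega, by omega, .inl rfl⟩

theorem mem_chainTrees {n : ℕ} (hn : 7 ≤ n) (E : Finset (Sym2 ℕ)) :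
    E ∈ chainTrees n ↔ IsFourTree E ∧ ∀ e ∈ E, e ∈ chainEdges n := by
  simp only [chainTrees, mem_union, mem_filter, mem_powersetCard, mem_image, mem_Ico]
  constructor
  · rintro (⟨⟨hE, hcard⟩, hend⟩ | ⟨m, hm, rfl⟩)
    · refine ⟨isFourTree_of_card hcard (fun e he hdiag => ?_) hend, fun e he => ?_⟩
      · have := hE he
        induction e with | _ i j
        simp only [mem_chainEdges, chainRel, Sym2.mk_isDiag_iff] at this hdiag
        omega
      · have := hE he
        induction e with | _ i j
        simp only [mem_chainEdges] at this ⊢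
        exact ⟨by omega, by omega, this.2.2⟩
    · refine ⟨isFourTree_tailPath hm.1, ?_⟩
      simp only [tailPath, mem_insert, mem_singleton, forall_eq_or_imp, forall_eq, mem_chainEdges,
        chainRel]
      omega
  · rintro ⟨h, hE⟩
    by_cases h7 : E ⊆ chainEdges 7
    · exact .inl ⟨⟨h7, h.card_eq_three⟩, h.card_endpoints⟩
    right
    have hrel : ∀ i j, s(i, j) ∈ E → i < n ∧ j < n ∧
        (i < 5 ∧ j < 5 ∨ j = i + 1 ∧ 4 ≤ i ∨ i = j + 1 ∧ 4 ≤ j) := by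
      intro i j hij
      have := mem_chainEdges.mp (hE _ hij)
      simp only [chainRel] at this
      omega
    obtain ⟨v, hv, hv7⟩ : ∃ v ∈ endpoints E, 7 ≤ v := by
      by_contra! hcon
      refine h7 fun e he => ?_
      have := hE e he
      induction e with | _ i j
      rw [mem_chainEdges] at this ⊢
      exact ⟨hcon i (mem_endpoints.mpr ⟨_, he, by simp⟩),
        hcon j (mem_endpoints.mpr ⟨_, he, by simp⟩), this.2.2⟩
    obtain ⟨a, b, c, d, hab, hac, had, hbc, hbd, hcd, rfl | rfl⟩ := h
    · have hv : v = a ∨ v = b ∨ v = c ∨ v = d := by simp [mem_endpoints] at hv; tauto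
      obtain ⟨ha, hb, h₁⟩ := hrel a b (by simp)
      obtain ⟨-, hc, h₂⟩ := hrel b c (by simp)
      obtain ⟨-, hd, h₃⟩ := hrel c d (by simp)
      clear hrel hE h7
      have : (4 ≤ a ∧ b = a + 1 ∧ c = a + 2 ∧ d = a + 3) ∨
          (4 ≤ d ∧ c = d + 1 ∧ b = d + 2 ∧ a = d + 3) := by
        rcases h₁ with h₁ | h₁ | h₁ <;> rcases h₂ with h₂ | h₂ | h₂ <;> omega
      obtain ⟨h4, rfl, rfl, rfl⟩ | ⟨h4, rfl, rfl, rfl⟩ := this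
      · exact ⟨a + 3, by omega, rfl⟩
      · exact ⟨d + 3, by omega, path_edges_reverse d (d + 1) (d + 2) (d + 3)⟩
    · have hv : v = a ∨ v = b ∨ v = c ∨ v = d := by simp [mem_endpoints] at hv; tauto
      obtain ⟨-, -, h₁⟩ := hrel a b (by simp)
      obtain ⟨-, -, h₂⟩ := hrel a c (by simp)
      obtain ⟨-, -, h₃⟩ := hrel a d (by simp)
      clear hrel hE h7
      rcases h₁ with h₁ | h₁ | h₁ <;> rcases h₂ with h₂ | h₂ | h₂ <;> omega

theorem card_chainTrees {n : ℕ} (hn : 7 ≤ n) : (chainTrees n).card = n + 95 := by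
  have htop : ∀ m, s(m - 1, m) ∈ tailPath m := by simp [tailPath]
  have hle : ∀ m i j, s(i, j) ∈ tailPath m → j ≤ m := by
    intro m i j h
    simp only [tailPath, mem_insert, mem_singleton, Sym2.eq_iff] at h
    omega
  rw [chainTrees, card_union_of_disjoint, card_filter_card_endpoints_chainEdges_seven,
    card_image_of_injective, Nat.card_Ico]
  · omega
  · intro m k h
    have h₁ := hle k _ _ (h ▸ htop m)
    have h₂ := hle m _ _ (h ▸ htop k)
    omega
  · rw [disjoint_left]
    simp only [mem_filter, mem_powersetCard, mem_image, mem_Ico, not_exists, not_and]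
    rintro _ ⟨⟨h, -⟩, -⟩ m hm rfl
    have := mem_chainEdges.mp (h (htop m))
    omega

theorem treeSubCount_chainK5 {n : ℕ} (hn : 7 ≤ n) : treeSubCount (chainK5 n) 4 = n + 95 := by
  rw [treeSubCount_four, ← card_chainTrees hn, ← Set.ncard_coe_finset,
    ← Set.ncard_image_of_injective _ (Finset.map_injective Fin.valEmbedding.sym2Map)]
  congr 1
  ext E
  simp only [Set.mem_image, Set.mem_ofPred_eq, mem_coe, mem_chainTrees hn, mem_edgeSet_chainK5]
  constructor
  · rintro ⟨E, ⟨h, hE⟩, rfl⟩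
    refine ⟨(isFourTree_map _).mpr h, ?_⟩
    simpa using hE
  · rintro ⟨h, hE⟩
    have hrange : (E : Set (Sym2 ℕ)) ⊆ Set.range (Fin.valEmbedding (n := n)).sym2Map := by
      intro e he
      have := hE e he
      induction e with | _ i j
      rw [mem_chainEdges] at this
      exact ⟨s(⟨i, this.1⟩, ⟨j, this.2.1⟩), rfl⟩
    obtain ⟨F, -, rfl⟩ := subset_map_iff.mp (fun e he => by simpa using hrange he :
      E ⊆ univ.map (Fin.valEmbedding (n := n)).sym2Map)
    exact ⟨F, ⟨(isFourTree_map _).mp h, by simpa using hE⟩, rfl⟩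

theorem val_lt_five_of_isClique {n : ℕ} {S : Finset (Fin n)} (hS : S.card = 4)
    (h : (chainK5 n).IsClique (S : Set (Fin n))) : ∀ x ∈ S, (x : ℕ) < 5 := by
  intro x hx
  by_contra! hx5
  have hsub : S.map Fin.valEmbedding ⊆ {(x : ℕ), (x : ℕ) - 1, (x : ℕ) + 1} := by
    intro y hy
    obtain ⟨y, hyS, rfl⟩ := Finset.mem_map.mp hy
    by_cases hxy : x = y
    · simp [hxy]
    have := h hx hyS hxy
    simp only [chainK5, SimpleGraph.fromRel_adj] at this
    simp
    omega
  have := (card_le_card hsub).trans card_le_three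
  rw [card_map] at this
  omega

theorem cliqueCount_chainK5 {n : ℕ} (hn : 5 ≤ n) : cliqueCount (chainK5 n) 4 = 5 := by
  rw [cliqueCount, ← show (powersetCard 4 (univ.filter fun x : Fin n => (x : ℕ) < 5)).card = 5 by
    rw [card_powersetCard, Fin.card_filter_val_lt, min_eq_right hn]; rfl]
  refine Nat.subtype_card _ fun S => ?_
  rw [mem_powersetCard, and_comm]
  refine and_congr_right fun hS => ⟨fun h x hx y hy hxy => ?_, fun h x hx => ?_⟩
  · have := (mem_filter.mp (h hx)).2
    have := (mem_filter.mp (h hy)).2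
    simp only [chainK5, SimpleGraph.fromRel_adj]
    tauto
  · exact mem_filter.mpr ⟨mem_univ x, val_lt_five_of_isClique hS h x hx⟩

theorem stmt15 (n : ℕ) (hn : 7 ≤ n) :
    cliqueCount (chainK5 n) 4 = 5 ∧
    treeSubCount (chainK5 n) 4 = n + 95 ∧
    (16 * (cliqueCount (chainK5 n) 4 : ℚ)) / (treeSubCount (chainK5 n) 4 : ℚ) =
      80 / ((n : ℚ) + 95) := by
  rw [cliqueCount_chainK5 (by omega), treeSubCount_chainK5 hn]
  norm_num
end
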